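/- Let n ≥ 1 and let w ∈ S_n be a permutation such that 𝔖_w is multiplicity-free (every nonzero coefficient of 𝔖_w equals 1). Let P' = {b ∈ ℕ^n : there exists a ∈ supp(𝔖_w) with a ≤ b componentwise}, partially ordered componentwise, and let μ : P' → ℤ be the unique function satisfying ∑_{a ∈ P', a ≤ b} μ(a) = 1 for every b ∈ P'. Then for every b ∈ ℕ^n, the coefficient of x^b in the Grothendieck polynomial 𝔊_w equals μ(b) if b ∈ P', and equals 0 otherwise. -/

import Mathlib

open scoped Classical
open MvPolynomial

noncomputable section

/-- `S` is the family of Schubert polynomials for `S_n` (indexing variables by `Fin n`,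
so the vector `(a_1, …, a_n)` corresponds to `a : Fin n →₀ ℕ`): the polynomial of the
longest element `w₀` (given by `Fin.revPerm`) is `x_1^{n-1} x_2^{n-2} ⋯ x_{n-1}`, and
whenever `w i > w (i+1)` we have `S (w * s_i) = ∂_i (S w)`, i.e.
`(x_i - x_{i+1}) * S (w * s_i) = S w - s_i (S w)`. -/
def IsSchubertFamily {n : ℕ} (S : Equiv.Perm (Fin n) → MvPolynomial (Fin n) ℤ) : Prop :=
  S Fin.revPerm = ∏ i : Fin n, X i ^ (Fin.rev i : ℕ) ∧
    ∀ (w : Equiv.Perm (Fin n)) (i j : Fin n), (j : ℕ) = (i : ℕ) + 1 → w j < w i →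
      (X i - X j) * S (w * Equiv.swap i j) = S w - rename (Equiv.swap i j) (S w)

/-- `G` is the family of Grothendieck polynomials for `S_n`:
`G w₀ = x_1^{n-1} x_2^{n-2} ⋯ x_{n-1}`, and whenever `w i > w (i+1)` we have
`G (w * s_i) = π_i (G w)` where `π_i f = ∂_i ((1 - x_{i+1}) f)`, i.e.
`(x_i - x_{i+1}) * G (w * s_i) = (1 - x_{i+1}) * G w - s_i ((1 - x_{i+1}) * G w)`. -/
def IsGrothendieckFamily {n : ℕ} (G : Equiv.Perm (Fin n) → MvPolynomial (Fin n) ℤ) : Prop :=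
  G Fin.revPerm = ∏ i : Fin n, X i ^ (Fin.rev i : ℕ) ∧
    ∀ (w : Equiv.Perm (Fin n)) (i j : Fin n), (j : ℕ) = (i : ℕ) + 1 → w j < w i →
      (X i - X j) * G (w * Equiv.swap i j) =
        (1 - X j) * G w - rename (Equiv.swap i j) ((1 - X j) * G w)

/-- A weighted sum of the values of a permutation, which drops when an ascent is exchanged. -/
def permWeight {n : ℕ} (w : Equiv.Perm (Fin n)) : ℕ := ∑ k : Fin n, (k : ℕ) * (w k : ℕ)

lemma permWeight_mul_swap_lt {n : ℕ} (w : Equiv.Perm (Fin n)) {i j : Fin n} (hij : i < j)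
    (h : w i < w j) : permWeight (w * Equiv.swap i j) < permWeight w := by
  have hne : i ≠ j := hij.ne
  have key : ∀ v : Equiv.Perm (Fin n), permWeight v =
      (∑ k ∈ (Finset.univ.erase i).erase j, (k : ℕ) * (v k : ℕ)) + (j : ℕ) * v j + (i : ℕ) * v i := by
    intro v
    unfold permWeight
    rw [← Finset.sum_erase_add _ _ (Finset.mem_univ i),
      ← Finset.sum_erase_add _ _ (Finset.mem_erase.2 ⟨hne.symm, Finset.mem_univ j⟩)]
  rw [key, key w]
  have : ∑ k ∈ (Finset.univ.erase i).erase j, (k : ℕ) * ((w * Equiv.swap i j) k : ℕ) =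
      ∑ k ∈ (Finset.univ.erase i).erase j, (k : ℕ) * (w k : ℕ) := by
    refine Finset.sum_congr rfl fun k hk => ?_
    simp only [Finset.mem_erase] at hk
    rw [Equiv.Perm.mul_apply, Equiv.swap_apply_of_ne_of_ne hk.2.1 hk.1]
  rw [this]
  simp only [Equiv.Perm.mul_apply, Equiv.swap_apply_left, Equiv.swap_apply_right]
  have h1 : (i : ℕ) < j := hij
  have h2 : (w i : ℕ) < w j := h
  nlinarith

lemma lt_of_no_ascent {n : ℕ} (w : Equiv.Perm (Fin n)) (lo hi : ℕ)
    (h : ∀ i j : Fin n, (j : ℕ) = i + 1 → lo ≤ i → (j : ℕ) ≤ hi → w j < w i)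
    {p q : Fin n} (hlo : lo ≤ p) (hpq : p < q) (hhi : (q : ℕ) ≤ hi) : w q < w p := by
  obtain ⟨d, hd⟩ : ∃ d, (q : ℕ) = p + d + 1 := ⟨q - p - 1, by have : (p : ℕ) < q := hpq; omega⟩
  induction d generalizing q with
  | zero => exact h p q (by omega) hlo hhi
  | succ d ih =>
    have hq := q.2
    let m : Fin n := ⟨p + d + 1, by omega⟩
    have hm : (m : ℕ) = p + d + 1 := rfl
    exact (h m q (by omega) (by omega) hhi).trans
      (ih (q := m) (Fin.lt_def.2 (by omega)) (by omega) rfl)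

lemma eq_revPerm_of_no_ascent {n : ℕ} (w : Equiv.Perm (Fin n))
    (h : ∀ i j : Fin n, (j : ℕ) = i + 1 → w j < w i) : w = Fin.revPerm := by
  have hanti : StrictAnti w := fun p q hpq =>
    lt_of_no_ascent w 0 n (fun i j hij _ _ => h i j hij) (Nat.zero_le _) hpq q.2.le
  have hm : StrictMono (fun k => w (Fin.rev k)) := fun p q hpq => hanti (Fin.rev_lt_rev.2 hpq)
  have hid : (fun k => w (Fin.rev k)) = id := by
    refine (hm.range_inj strictMono_id).1 ?_
    rw [Set.range_id]
    exact (w.surjective.comp Fin.rev_surjective).range_eq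
  ext k : 1
  have := congrFun hid (Fin.rev k)
  simpa using this

/-- A permutation other than the longest one has an ascent at a left-to-right minimum. -/
lemma exists_first_ascent {n : ℕ} (w : Equiv.Perm (Fin n)) (hw : w ≠ Fin.revPerm) :
    ∃ i j : Fin n, (j : ℕ) = i + 1 ∧ w i < w j ∧ ∀ q < i, w i < w q := by
  have hex : ∃ k : ℕ, ∃ i j : Fin n, (i : ℕ) = k ∧ (j : ℕ) = i + 1 ∧ w i < w j := by
    by_contra hcon
    push Not at hcon
    refine hw (eq_revPerm_of_no_ascent w fun i j hij => ?_)
    refine lt_of_le_of_ne (hcon i i j rfl hij) fun he => ?_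
    have := w.injective he
    subst this
    omega
  obtain ⟨i, j, hik, hij, hlt⟩ := Nat.find_spec hex
  refine ⟨i, j, hij, hlt, fun q hq => ?_⟩
  refine lt_of_no_ascent w 0 i (fun a b hab _ hbi => ?_) (Nat.zero_le _) hq le_rfl
  by_contra hcon
  refine Nat.find_min hex (m := a) (by omega) ⟨a, b, rfl, hab, lt_of_le_of_ne (not_lt.1 hcon) ?_⟩
  intro he
  have := w.injective he
  subst this
  omega

lemma X_sub_X_ne_zero {n : ℕ} {i j : Fin n} (h : i ≠ j) :
    (X i - X j : MvPolynomial (Fin n) ℤ) ≠ 0 :=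
  sub_ne_zero.2 fun he => h (X_injective he)

lemma rename_swap_rename_swap {n : ℕ} (i j : Fin n) (P : MvPolynomial (Fin n) ℤ) :
    rename (Equiv.swap i j) (rename (Equiv.swap i j) P) = P := by
  rw [rename_rename]
  have : (Equiv.swap i j : Fin n → Fin n) ∘ Equiv.swap i j = id := by
    ext k; simp
  rw [this, rename_id_apply]

namespace IsSchubertFamily

variable {n : ℕ} {S : Equiv.Perm (Fin n) → MvPolynomial (Fin n) ℤ}

lemma rename_swap_eq_self (hS : IsSchubertFamily S) (w : Equiv.Perm (Fin n)) {i j : Fin n}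
    (hij : (j : ℕ) = i + 1) (h : w i < w j) : rename (Equiv.swap i j) (S w) = S w := by
  have h1 := hS.2 (w * Equiv.swap i j) i j hij (by simpa using h)
  rw [mul_assoc, Equiv.swap_mul_self, mul_one] at h1
  have h2 := congrArg (rename (Equiv.swap i j)) h1
  simp only [map_mul, map_sub, rename_X, Equiv.swap_apply_left, Equiv.swap_apply_right,
    rename_swap_rename_swap] at h2
  have hne : i ≠ j := by rintro rfl; omega
  refine mul_left_cancel₀ (X_sub_X_ne_zero hne) ?_
  linear_combination -h1 - h2

/-- The divided difference of `S w`, expressed through the family. -/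
lemma mul_ite_descent (hS : IsSchubertFamily S) (w : Equiv.Perm (Fin n)) {i j : Fin n}
    (hij : (j : ℕ) = i + 1) :
    (X i - X j) * (if w j < w i then S (w * Equiv.swap i j) else 0) =
      S w - rename (Equiv.swap i j) (S w) := by
  split_ifs with h
  · exact hS.2 w i j hij h
  · have hne : i ≠ j := by rintro rfl; omega
    rw [hS.rename_swap_eq_self w hij
      (lt_of_le_of_ne (not_lt.1 h) fun he => hne (w.injective he)), mul_zero, sub_self]

end IsSchubertFamily

/-- `w * swap r j` covers `w` in Bruhat order, for `r < j`. -/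
def IsCoverAt {n : ℕ} (w : Equiv.Perm (Fin n)) (r j : Fin n) : Prop :=
  r < j ∧ w r < w j ∧ ∀ m, r < m → m < j → ¬ (w r < w m ∧ w m < w j)

lemma isCoverAt_swap_iff {n : ℕ} (w : Equiv.Perm (Fin n)) {r k l : Fin n}
    (hkl : (l : ℕ) = k + 1) (hasc : w k < w l) (hkr : k ≠ r) (hlr : l ≠ r) (j : Fin n) :
    (IsCoverAt (w * Equiv.swap k l) r j ∧
      (w * Equiv.swap k l * Equiv.swap r j) l < (w * Equiv.swap k l * Equiv.swap r j) k) ↔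
    IsCoverAt w r (Equiv.swap k l j) := by
  set v := w * Equiv.swap k l with hv
  have vk : v k = w l := by simp [hv]
  have vl : v l = w k := by simp [hv]
  have vo : ∀ m, m ≠ k → m ≠ l → v m = w m := fun m h1 h2 => by
    simp [hv, Equiv.swap_apply_of_ne_of_ne h1 h2]
  have vr : v r = w r := vo r hkr.symm hlr.symm
  have hne : k ≠ l := by rintro rfl; omega
  have hinj : w k ≠ w r := fun h => hkr (w.injective h)
  simp only [Equiv.Perm.mul_apply, IsCoverAt, vr]
  rcases eq_or_ne j k with rfl | hjk
  · rw [Equiv.swap_apply_of_ne_of_ne hlr hne.symm, Equiv.swap_apply_right,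
      Equiv.swap_apply_left, vk, vl, vr]
    constructor
    · rintro ⟨⟨h1, h2, h3⟩, h4⟩
      refine ⟨by omega, h2, fun m h5 h6 h7 => ?_⟩
      rcases eq_or_ne m j with rfl | hm
      · omega
      · refine h3 m h5 (by omega) ?_
        rwa [vo m hm (by omega)]
    · rintro ⟨h1, h2, h3⟩
      refine ⟨⟨by omega, h2, fun m h5 h6 h7 => ?_⟩, ?_⟩
      · rw [vo m (by omega) (by omega)] at h7
        exact h3 m h5 (by omega) h7
      · have := h3 j (by omega) (by omega)
        omega
  rcases eq_or_ne j l with rfl | hjl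
  · rw [Equiv.swap_apply_of_ne_of_ne hkr hne, Equiv.swap_apply_right,
      Equiv.swap_apply_right, vk, vl, vr]
    constructor
    · rintro ⟨⟨h1, h2, h3⟩, h4⟩
      refine ⟨by omega, h2, fun m h5 h6 h7 => ?_⟩
      refine h3 m h5 (by omega) ?_
      rwa [vo m (by omega) (by omega)]
    · rintro ⟨h1, h2, h3⟩
      refine ⟨⟨by omega, h2, fun m h5 h6 h7 => ?_⟩, by omega⟩
      rcases eq_or_ne m k with rfl | hm
      · omega
      · rw [vo m hm (by omega)] at h7
        exact h3 m h5 (by omega) h7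
  rw [Equiv.swap_apply_of_ne_of_ne hjk hjl, vo j hjk hjl]
  rcases eq_or_ne j r with rfl | hjr
  · simp
  rw [Equiv.swap_apply_of_ne_of_ne hlr hjl.symm, Equiv.swap_apply_of_ne_of_ne hkr hjk.symm, vk, vl]
  refine ⟨fun ⟨⟨h1, h2, h3⟩, _⟩ => ⟨h1, h2, fun m h5 h6 h7 => ?_⟩,
    fun ⟨h1, h2, h3⟩ => ⟨⟨h1, h2, fun m h5 h6 h7 => ?_⟩, hasc⟩⟩
  · rcases eq_or_ne m k with rfl | hmk
    · exact h3 l (by omega) (by omega) (by rwa [vl])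
    rcases eq_or_ne m l with rfl | hml
    · exact h3 k (by omega) (by omega) (by rwa [vk])
    exact h3 m h5 h6 (by rwa [vo m hmk hml])
  · rcases eq_or_ne m k with rfl | hmk
    · exact h3 l (by omega) (by omega) (by rwa [← vk])
    rcases eq_or_ne m l with rfl | hml
    · exact h3 k (by omega) (by omega) (by rwa [← vl])
    exact h3 m h5 h6 (by rwa [← vo m hmk hml])

lemma sub_mul_monomial_eq {n : ℕ} {k r : Fin n} (hkr : k ≠ r) (d : Fin n →₀ ℕ)
    (hd : d k = d r + 1) :
    (X k - X r) * monomial (d - Finsupp.single k 1) (1 : ℤ) =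
      monomial d 1 - rename (Equiv.swap k r) (monomial d 1) := by
  rw [rename_monomial, sub_mul, X, X, monomial_mul, monomial_mul, one_mul]
  have h1 : Finsupp.single k 1 + (d - Finsupp.single k 1) = d := by
    ext m
    rcases eq_or_ne m k with rfl | h
    · simp; omega
    · simp [h.symm]
  have h2 : Finsupp.single r 1 + (d - Finsupp.single k 1) = d.mapDomain (Equiv.swap k r) := by
    ext m
    rw [← Finsupp.equivMapDomain_eq_mapDomain, Finsupp.equivMapDomain_apply, Equiv.symm_swap]
    rcases eq_or_ne m k with rfl | h
    · simp [hkr.symm]; omega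
    rcases eq_or_ne m r with rfl | h'
    · simp [hkr]; omega
    · simp [h.symm, h'.symm, Equiv.swap_apply_of_ne_of_ne h h']
  rw [h1, h2]

lemma prod_X_pow_rev (n : ℕ) : (∏ i : Fin n, X i ^ (Fin.rev i : ℕ) : MvPolynomial (Fin n) ℤ) =
    monomial (Finsupp.equivFunOnFinite.symm fun i => (Fin.rev i : ℕ)) 1 := by
  rw [monomial_eq, Finsupp.prod_fintype _ _ (by simp)]
  simp

lemma swap_mul_swap_mul_swap {α : Type*} [DecidableEq α] (k l a b : α) :
    Equiv.swap k l * (Equiv.swap a b * Equiv.swap k l) =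
      Equiv.swap (Equiv.swap k l a) (Equiv.swap k l b) := by
  rw [Equiv.swap_apply_apply, Equiv.swap_inv, mul_assoc]

namespace IsSchubertFamily

variable {n : ℕ} {S : Equiv.Perm (Fin n) → MvPolynomial (Fin n) ℤ}

lemma exists_eq_monomial (hS : IsSchubertFamily S) : ∀ (u : Equiv.Perm (Fin n)) (r : Fin n),
    (∀ k l : Fin n, (l : ℕ) = k + 1 → u k < u l → l = r) →
    (∀ q j : Fin n, q ≤ r → r < j → u j < u q) →
    ∃ d : Fin n →₀ ℕ, S u = monomial d 1 ∧ ∀ k, r ≤ k → d k = Fin.rev k := by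
  intro u
  induction hN : permWeight u using Nat.strong_induction_on generalizing u with
  | _ N ih =>
  intro r hasc hdom
  by_cases h : ∃ k : Fin n, (r : ℕ) = k + 1 ∧ u k < u r
  · obtain ⟨k, hk, hlt⟩ := h
    have hkr : k ≠ r := by rintro rfl; omega
    set v := u * Equiv.swap k r with hv
    have vk : v k = u r := by simp [hv]
    have vr : v r = u k := by simp [hv]
    have vo : ∀ m, m ≠ k → m ≠ r → v m = u m := fun m h1 h2 => by
      simp [hv, Equiv.swap_apply_of_ne_of_ne h1 h2]
    have hdec : ∀ q, q < k → u k < u q := fun q hq =>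
      lt_of_no_ascent u 0 k (fun a b hab _ hbk => by
        by_contra hcon
        have hab' : a ≠ b := by rintro rfl; omega
        have := hasc a b hab (lt_of_le_of_ne (not_lt.1 hcon) fun he => hab' (u.injective he))
        subst this
        omega) (Nat.zero_le _) hq le_rfl
    obtain ⟨d, hd, hd'⟩ := ih _ (hN ▸ permWeight_mul_swap_lt u (by omega) hlt) v rfl k
      (fun a b hab hlt' => by
        by_contra hbk
        rcases eq_or_ne a k with rfl | hak
        · have : b = r := by omega
          subst this
          omega
        rcases eq_or_ne a r with rfl | har
        · rw [vr, vo b hbk (by omega)] at hlt'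
          have := hdom k b (by omega) (by omega)
          omega
        · have : b ≠ r := by omega
          rw [vo a hak har, vo b hbk this] at hlt'
          exact this (hasc a b hab hlt'))
      (fun q j hq hj => by
        rcases eq_or_ne j r with rfl | hjr
        · rw [vr]
          rcases eq_or_ne q k with rfl | hqk
          · rwa [vk]
          · rw [vo q hqk (by omega)]
            exact hdec q (by omega)
        · rw [vo j (by omega) hjr]
          rcases eq_or_ne q k with rfl | hqk
          · rw [vk]; exact hdom r j le_rfl (by omega)
          · rw [vo q hqk (by omega)]; exact hdom q j (by omega) (by omega))
    refine ⟨d - Finsupp.single k 1, ?_, fun m hm => ?_⟩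
    · have h1 := hS.2 v k r hk (by rwa [vk, vr])
      rw [hv, mul_assoc, Equiv.swap_mul_self, mul_one, ← hv, hd, ← sub_mul_monomial_eq hkr] at h1
      · exact mul_left_cancel₀ (X_sub_X_ne_zero hkr) h1
      · rw [hd' k le_rfl, hd' r (by omega)]
        simp only [Fin.val_rev]
        omega
    · have : k ≠ m := by rintro rfl; omega
      simp [this, hd' m (by omega)]
  · have hu : u = Fin.revPerm := by
      refine eq_revPerm_of_no_ascent u fun i j hij => ?_
      by_contra hcon
      have hij' : i ≠ j := by rintro rfl; omega
      have hlt := lt_of_le_of_ne (not_lt.1 hcon) fun he => hij' (u.injective he)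
      have := hasc i j hij hlt
      subst this
      exact h ⟨i, hij, hlt⟩
    exact ⟨_, by rw [hu, hS.1, prod_X_pow_rev], fun k _ => by simp⟩

lemma mul_eq_sum_of_swap (hS : IsSchubertFamily S) (w : Equiv.Perm (Fin n)) {r k l : Fin n}
    (hkl : (l : ℕ) = k + 1) (hasc : w k < w l) (hkr : k ≠ r) (hlr : l ≠ r)
    (ih : X r * S (w * Equiv.swap k l) = ∑ j, if IsCoverAt (w * Equiv.swap k l) r j then
      S (w * Equiv.swap k l * Equiv.swap r j) else 0) :
    X r * S w = ∑ j, if IsCoverAt w r j then S (w * Equiv.swap r j) else 0 := by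
  have hne : k ≠ l := by rintro rfl; omega
  set v := w * Equiv.swap k l with hv
  have h1 := hS.2 v k l hkl (by simpa [hv] using hasc)
  rw [hv, mul_assoc, Equiv.swap_mul_self, mul_one, ← hv] at h1
  refine mul_left_cancel₀ (X_sub_X_ne_zero hne) ?_
  have h2 : (X k - X l) * (X r * S w) =
      X r * S v - rename (Equiv.swap k l) (X r * S v) := by
    rw [map_mul, rename_X, Equiv.swap_apply_of_ne_of_ne hkr.symm hlr.symm]
    linear_combination X r * h1
  have key : ∀ j, (X k - X l) * (if IsCoverAt w r (Equiv.swap k l j) then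
      S (w * Equiv.swap r (Equiv.swap k l j)) else 0) =
      (if IsCoverAt v r j then S (v * Equiv.swap r j) else 0) -
      rename (Equiv.swap k l) (if IsCoverAt v r j then S (v * Equiv.swap r j) else 0) := by
    intro j
    have hmul : v * Equiv.swap r j * Equiv.swap k l = w * Equiv.swap r (Equiv.swap k l j) := by
      rw [hv, mul_assoc, mul_assoc, swap_mul_swap_mul_swap,
        Equiv.swap_apply_of_ne_of_ne hkr.symm hlr.symm]
    have h3 := hS.mul_ite_descent (v * Equiv.swap r j) hkl
    rw [hmul] at h3
    have h4 := isCoverAt_swap_iff w hkl hasc hkr hlr j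
    rw [← hv] at h4
    by_cases hc : IsCoverAt v r j
    · simp only [hc, true_and] at h4
      simp only [← h4, hc, if_true]
      exact h3
    · simp only [hc, false_and, false_iff] at h4
      simp [h4, hc]
  rw [h2, ih, map_sum, ← Finset.sum_sub_distrib, ← Equiv.sum_comp (Equiv.swap k l) fun j =>
    if IsCoverAt w r j then S (w * Equiv.swap r j) else 0, Finset.mul_sum]
  exact Finset.sum_congr rfl fun j _ => (key j).symm

/-- The cotransition formula: at a left-to-right minimum `w r` with a larger value to its right,
`X r * S w` is the sum of the Schubert polynomials of the covers of `w` exchanging position `r`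
with a later one. -/
theorem X_mul_eq_sum (hS : IsSchubertFamily S) : ∀ (w : Equiv.Perm (Fin n)) (r : Fin n),
    (∀ q < r, w r < w q) → (∃ j, r < j ∧ w r < w j) →
    X r * S w = ∑ j, if IsCoverAt w r j then S (w * Equiv.swap r j) else 0 := by
  intro w
  induction hN : permWeight w using Nat.strong_induction_on generalizing w with
  | _ N ih =>
  intro r hmin hex
  by_cases h : ∃ k l : Fin n, (l : ℕ) = k + 1 ∧ w k < w l ∧ k ≠ r
  · obtain ⟨k, l, hkl, hasc, hkr⟩ := h
    have hlr : l ≠ r := by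
      rintro rfl
      have := hmin k (by omega)
      omega
    have vo : ∀ m, (w * Equiv.swap k l) m = w (Equiv.swap k l m) := fun m => rfl
    refine hS.mul_eq_sum_of_swap w hkl hasc hkr hlr
      (ih _ (hN ▸ permWeight_mul_swap_lt w (by omega) hasc) _ rfl r (fun q hq => ?_) ?_)
    · rw [vo, vo, Equiv.swap_apply_of_ne_of_ne hkr.symm hlr.symm]
      refine hmin _ ?_
      rw [Equiv.swap_apply_def]
      split_ifs <;> omega
    · obtain ⟨j, hj, hwj⟩ := hex
      refine ⟨Equiv.swap k l j, ?_, ?_⟩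
      · rw [Equiv.swap_apply_def]
        split_ifs <;> omega
      · rw [vo, vo, Equiv.swap_apply_of_ne_of_ne hkr.symm hlr.symm, Equiv.swap_apply_self]
        exact hwj
  push Not at h
  obtain ⟨j₀, hj₀, hwj₀⟩ := hex
  have hdec : ∀ p q : Fin n, r < p → p < q → w q < w p := fun p q hp hpq =>
    lt_of_no_ascent w (r + 1) n (fun a b hab hra _ => by
      by_contra hcon
      have hab' : a ≠ b := by rintro rfl; omega
      have := h a b hab (lt_of_le_of_ne (not_lt.1 hcon) fun he => hab' (w.injective he))
      subst this
      omega) (by omega) hpq q.2.le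
  obtain ⟨s, hs⟩ : ∃ s : Fin n, (s : ℕ) = r + 1 := ⟨⟨r + 1, by omega⟩, rfl⟩
  have hws : w r < w s := by
    rcases eq_or_ne j₀ s with rfl | hne
    · exact hwj₀
    · exact hwj₀.trans (hdec s j₀ (by omega) (by omega))
  have hrs : r ≠ s := by rintro rfl; omega
  set u := w * Equiv.swap r s with hu
  have ur : u r = w s := by simp [hu]
  have us : u s = w r := by simp [hu]
  have uo : ∀ m, m ≠ r → m ≠ s → u m = w m := fun m h1 h2 => by
    simp [hu, Equiv.swap_apply_of_ne_of_ne h1 h2]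
  have h1 := hS.2 u r s hs (by rwa [ur, us])
  rw [hu, mul_assoc, Equiv.swap_mul_self, mul_one, ← hu] at h1
  by_cases hB : ∃ j, s < j ∧ w r < w j
  · have h2 := ih _ (hN ▸ permWeight_mul_swap_lt w (by omega) hws) u rfl s (fun q hq => by
      rcases eq_or_ne q r with rfl | hqr
      · rwa [ur, us]
      · rw [us, uo q hqr (by omega)]
        exact hmin q (by omega)) (by
      obtain ⟨j, hj, hwj⟩ := hB
      exact ⟨j, hj, by rwa [us, uo j (by omega) (by omega)]⟩)
    refine mul_left_cancel₀ (X_sub_X_ne_zero hrs) ?_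
    have h3 : (X r - X s) * (X r * S w) = (X r - X s) * S u +
        (X s * S u - rename (Equiv.swap r s) (X s * S u)) := by
      rw [map_mul, rename_X, Equiv.swap_apply_right]
      linear_combination X r * h1
    have key : ∀ j, (X r - X s) * (if IsCoverAt w r j then S (w * Equiv.swap r j) else 0) =
        (if j = s then (X r - X s) * S u else 0) +
        ((if IsCoverAt u s j then S (u * Equiv.swap s j) else 0) -
        rename (Equiv.swap r s) (if IsCoverAt u s j then S (u * Equiv.swap s j) else 0)) := by
      intro j
      rcases eq_or_ne j s with rfl | hjs
      · have hc1 : IsCoverAt w r j := ⟨by omega, hws, fun m h1 h2 => by omega⟩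
        have hc2 : ¬ IsCoverAt u j j := fun h => lt_irrefl _ h.1
        rw [if_pos hc1, if_neg hc2, if_pos rfl, map_zero, sub_zero, add_zero]
      rcases eq_or_ne j r with rfl | hjr
      · have hc1 : ¬ IsCoverAt w j j := fun h => lt_irrefl _ h.1
        have hc2 : ¬ IsCoverAt u s j := fun h => by have := h.1; omega
        simp [hc1, hc2, hjs]
      have hmul : u * Equiv.swap s j * Equiv.swap r s = w * Equiv.swap r j := by
        rw [hu, mul_assoc, mul_assoc, swap_mul_swap_mul_swap, Equiv.swap_apply_right,
          Equiv.swap_apply_of_ne_of_ne hjr hjs]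
      have h4 := hS.mul_ite_descent (u * Equiv.swap s j) hs
      rw [hmul] at h4
      have h5 : (IsCoverAt u s j ∧ (u * Equiv.swap s j) s < (u * Equiv.swap s j) r) ↔
          IsCoverAt w r j := by
        simp only [IsCoverAt, Equiv.Perm.mul_apply, Equiv.swap_apply_left, us, uo j hjr hjs,
          Equiv.swap_apply_of_ne_of_ne hrs hjr.symm, ur]
        constructor
        · rintro ⟨⟨h6, h7, h8⟩, h9⟩
          refine ⟨by omega, h7, fun m h10 h11 => ?_⟩
          rcases eq_or_ne m s with rfl | hms
          · omega
          · have := h8 m (by omega) h11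
            rwa [uo m (by omega) hms] at this
        · rintro ⟨h6, h7, h8⟩
          have h9 := h8 s (by omega) (by omega)
          have h10 : w j ≠ w s := fun he => hjs (w.injective he)
          refine ⟨⟨by omega, h7, fun m h11 h12 => ?_⟩, by omega⟩
          rw [uo m (by omega) (by omega)]
          exact h8 m (by omega) h12
      by_cases hc : IsCoverAt u s j
      · simp only [hc, true_and] at h5
        simp only [h5] at h4
        simp only [hc, if_true, hjs, if_false, zero_add]
        exact h4
      · simp only [hc, false_and, false_iff] at h5
        simp [h5, hc, hjs]
    rw [h3, h2, map_sum, ← Finset.sum_sub_distrib, Finset.mul_sum,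
      Finset.sum_congr rfl fun j _ => key j, Finset.sum_add_distrib]
    simp
  · push Not at hB
    obtain ⟨d, hd, hd'⟩ := hS.exists_eq_monomial u r (fun a b hab hlt => by
        by_contra hbr
        rcases eq_or_ne a r with rfl | har
        · have : b = s := by omega
          subst this
          omega
        rcases eq_or_ne a s with rfl | has
        · rw [us, uo b hbr (by omega)] at hlt
          have := hB b (by omega)
          omega
        · have hbs : b ≠ s := by omega
          rw [uo a har has, uo b hbr hbs] at hlt
          exact har (h a b hab hlt))
      (fun q j hq hj => by
        have hjr : w j ≠ w r := fun he => by have := w.injective he; omega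
        rcases eq_or_ne q r with rfl | hqr
        · rw [ur]
          rcases eq_or_ne j s with rfl | hjs
          · rwa [us]
          · rw [uo j (by omega) hjs]
            have := hB j (by omega)
            omega
        · rw [uo q hqr (by omega)]
          have := hmin q (by omega)
          rcases eq_or_ne j s with rfl | hjs
          · rwa [us]
          · rw [uo j (by omega) hjs]
            have := hB j (by omega)
            omega)
    have hdr : d r = d s + 1 := by
      rw [hd' r le_rfl, hd' s (by omega)]
      simp only [Fin.val_rev]
      omega
    rw [hd, ← sub_mul_monomial_eq hrs d hdr] at h1
    have h2 := mul_left_cancel₀ (X_sub_X_ne_zero hrs) h1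
    rw [Finset.sum_eq_single s]
    · rw [if_pos ⟨by omega, hws, fun m h1 h2 => by omega⟩, ← hu, hd, h2, X, monomial_mul, one_mul]
      refine congrArg (fun e => monomial e (1 : ℤ)) (Finsupp.ext fun m => ?_)
      rcases eq_or_ne m r with rfl | hm
      · simp; omega
      · simp [hm.symm]
    · intro j _ hjs
      refine if_neg fun hc => ?_
      have h3 := hc.1
      have h4 := hc.2.1
      have := hB j (by omega)
      omega
    · simp


lemma coeff_nonneg (hS : IsSchubertFamily S) (w : Equiv.Perm (Fin n)) (a : Fin n →₀ ℕ) :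
    0 ≤ coeff a (S w) := by
  induction hN : permWeight w using Nat.strong_induction_on generalizing w a with
  | _ N ih =>
  by_cases hw : w = Fin.revPerm
  · rw [hw, hS.1, prod_X_pow_rev, coeff_monomial]
    split_ifs <;> simp
  obtain ⟨i, j, hij, hlt, hmin⟩ := exists_first_ascent w hw
  have h := congrArg (coeff (Finsupp.single i 1 + a))
    (hS.X_mul_eq_sum w i hmin ⟨j, by omega, hlt⟩)
  rw [coeff_X_mul, coeff_sum] at h
  rw [h]
  refine Finset.sum_nonneg fun m _ => ?_
  split_ifs with hc
  · exact ih _ (hN ▸ permWeight_mul_swap_lt w hc.1 hc.2.1) _ _ rfl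
  · simp

lemma coeff_swap_le (hS : IsSchubertFamily S) (w : Equiv.Perm (Fin n)) {i j : Fin n}
    (hij : (j : ℕ) = i + 1) (hlt : w i < w j) (hmin : ∀ q < i, w i < w q) (a : Fin n →₀ ℕ) :
    coeff a (S (w * Equiv.swap i j)) ≤ coeff a (X i * S w) := by
  rw [hS.X_mul_eq_sum w i hmin ⟨j, by omega, hlt⟩, coeff_sum]
  have hc : IsCoverAt w i j := ⟨by omega, hlt, fun m h1 h2 => by omega⟩
  have h := Finset.single_le_sum (f := fun m =>
    coeff a (if IsCoverAt w i m then S (w * Equiv.swap i m) else 0)) (fun m _ => by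
      split_ifs
      · exact hS.coeff_nonneg _ _
      · simp) (Finset.mem_univ j)
  simpa only [if_pos hc] using h

end IsSchubertFamily

/-- The sum of the coefficients of the monomials dividing `x^b`. -/
def coeffSum {n : ℕ} (b : Fin n →₀ ℕ) : MvPolynomial (Fin n) ℤ →ₗ[ℤ] ℤ :=
  ∑ a ∈ Finset.Iic b, lcoeff ℤ a

lemma coeffSum_apply {n : ℕ} (b : Fin n →₀ ℕ) (P : MvPolynomial (Fin n) ℤ) :
    coeffSum b P = ∑ a ∈ Finset.Iic b, coeff a P := by
  simp [coeffSum, LinearMap.sum_apply, lcoeff]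

/-- A family of linear functionals indexed by exponents which is compatible with multiplication
by variables and with exchanging two variables. -/
structure IsShiftFamily {n : ℕ} (T : (Fin n →₀ ℕ) → MvPolynomial (Fin n) ℤ →ₗ[ℤ] ℤ) : Prop where
  X_mul : ∀ i b P, T b (X i * P) = if b i = 0 then 0 else T (b - Finsupp.single i 1) P
  rename_swap : ∀ i j b P, T b (rename (Equiv.swap i j) P) = T (b.mapDomain (Equiv.swap i j)) P

lemma mapDomain_swap_mapDomain_swap {n : ℕ} (i j : Fin n) (b : Fin n →₀ ℕ) :
    (b.mapDomain (Equiv.swap i j)).mapDomain (Equiv.swap i j) = b := by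
  ext m
  simp [Finsupp.mapDomain_equiv_apply]

lemma coeff_rename_swap {n : ℕ} (i j : Fin n) (b : Fin n →₀ ℕ) (P : MvPolynomial (Fin n) ℤ) :
    coeff b (rename (Equiv.swap i j) P) = coeff (b.mapDomain (Equiv.swap i j)) P := by
  conv_lhs => rw [← mapDomain_swap_mapDomain_swap i j b]
  rw [coeff_rename_mapDomain _ (Equiv.injective _)]

lemma isShiftFamily_lcoeff (n : ℕ) : IsShiftFamily (n := n) (lcoeff ℤ) where
  X_mul i b P := by
    simp only [lcoeff_apply, coeff_X_mul', Finsupp.mem_support_iff, ite_not]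
  rename_swap i j b P := coeff_rename_swap i j b P

lemma mapDomain_swap_le_mapDomain_swap {n : ℕ} (i j : Fin n) {a b : Fin n →₀ ℕ} (h : a ≤ b) :
    a.mapDomain (Equiv.swap i j) ≤ b.mapDomain (Equiv.swap i j) := by
  intro m
  rw [Finsupp.mapDomain_equiv_apply, Finsupp.mapDomain_equiv_apply]
  exact h _

lemma isShiftFamily_coeffSum (n : ℕ) : IsShiftFamily (n := n) coeffSum where
  X_mul i b P := by
    simp only [coeffSum_apply, coeff_X_mul', Finsupp.mem_support_iff, ite_not]
    split_ifs with hb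
    · refine Finset.sum_eq_zero fun a ha => if_pos ?_
      have := Finset.mem_Iic.1 ha i
      omega
    · rw [← Finset.sum_filter_add_sum_filter_not _ (fun a : Fin n →₀ ℕ => a i = 0),
        Finset.sum_eq_zero (fun a ha => if_pos (Finset.mem_filter.1 ha).2), zero_add]
      refine Finset.sum_nbij' (fun a => a - Finsupp.single i 1) (fun a => a + Finsupp.single i 1)
        ?_ ?_ ?_ ?_ ?_
      · intro a ha
        simp only [Finset.mem_filter, Finset.mem_Iic] at ha ⊢
        exact tsub_le_tsub_right ha.1 _
      · intro a ha
        simp only [Finset.mem_filter, Finset.mem_Iic] at ha ⊢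
        refine ⟨fun m => ?_, by simp⟩
        have := ha m
        rcases eq_or_ne i m with rfl | h
        · simp at this ⊢; omega
        · simpa [h] using this
      · intro a ha
        simp only [Finset.mem_filter, Finset.mem_Iic] at ha
        ext m
        rcases eq_or_ne i m with rfl | h
        · simp; omega
        · simp [h]
      · intro a _
        exact add_tsub_cancel_right _ _
      · intro a ha
        exact if_neg (Finset.mem_filter.1 ha).2
  rename_swap i j b P := by
    simp only [coeffSum_apply, coeff_rename_swap]
    refine Finset.sum_nbij' (fun a => a.mapDomain (Equiv.swap i j))
      (fun a => a.mapDomain (Equiv.swap i j)) ?_ ?_ ?_ ?_ ?_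
    · intro a ha
      exact Finset.mem_Iic.2 (mapDomain_swap_le_mapDomain_swap i j (Finset.mem_Iic.1 ha))
    · intro a ha
      have := mapDomain_swap_le_mapDomain_swap i j (Finset.mem_Iic.1 ha)
      rw [mapDomain_swap_mapDomain_swap] at this
      exact Finset.mem_Iic.2 this
    · intro a _
      exact mapDomain_swap_mapDomain_swap i j a
    · intro a _
      exact mapDomain_swap_mapDomain_swap i j a
    · intro a _
      rfl

/-- The exponent `c` with its entries at `i` and `j` replaced. -/
def put {n : ℕ} (c : Fin n →₀ ℕ) (i j : Fin n) (p q : ℕ) : Fin n →₀ ℕ :=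
  (c.update i p).update j q

section put

variable {n : ℕ} (c : Fin n →₀ ℕ) {i j : Fin n}

lemma put_apply (hij : i ≠ j) (p q : ℕ) (m : Fin n) :
    put c i j p q m = if m = i then p else if m = j then q else c m := by
  simp only [put, Finsupp.coe_update, Function.update_apply]
  split_ifs <;> simp_all

lemma put_self (i j : Fin n) : put c i j (c i) (c j) = c := by
  ext m
  simp only [put, Finsupp.coe_update, Function.update_apply]
  split_ifs <;> simp_all

lemma mapDomain_put (hij : i ≠ j) (p q : ℕ) :
    (put c i j p q).mapDomain (Equiv.swap i j) = put c i j q p := by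
  ext m
  rw [Finsupp.mapDomain_equiv_apply, Equiv.symm_swap, put_apply c hij, put_apply c hij,
    Equiv.swap_apply_def]
  split_ifs <;> simp_all

lemma put_sub_single_left (hij : i ≠ j) (p q : ℕ) :
    put c i j p q - Finsupp.single i 1 = put c i j (p - 1) q := by
  ext m
  rw [Finsupp.tsub_apply, put_apply c hij, put_apply c hij, Finsupp.single_apply]
  split_ifs <;> omega

lemma put_sub_single_right (hij : i ≠ j) (p q : ℕ) :
    put c i j p q - Finsupp.single j 1 = put c i j p (q - 1) := by
  ext m
  rw [Finsupp.tsub_apply, put_apply c hij, put_apply c hij, Finsupp.single_apply]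
  split_ifs <;> omega

end put

/-- The values of a family of functionals on a polynomial when the entries at `i` and `j` of the
exponent `c` vary, extended by zero to negative entries. -/
def slice {n : ℕ} (T : (Fin n →₀ ℕ) → MvPolynomial (Fin n) ℤ →ₗ[ℤ] ℤ) (c : Fin n →₀ ℕ)
    (i j : Fin n) (P : MvPolynomial (Fin n) ℤ) (p q : ℤ) : ℤ :=
  if 0 ≤ p ∧ 0 ≤ q then T (put c i j p.toNat q.toNat) P else 0

section slice

variable {n : ℕ} {T : (Fin n →₀ ℕ) → MvPolynomial (Fin n) ℤ →ₗ[ℤ] ℤ} (c : Fin n →₀ ℕ)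
  {i j : Fin n}

lemma slice_natCast (P : MvPolynomial (Fin n) ℤ) (p q : ℕ) :
    slice T c i j P p q = T (put c i j p q) P := by
  simp [slice]

lemma slice_self (P : MvPolynomial (Fin n) ℤ) :
    slice T c i j P (c i) (c j) = T c P := by
  rw [slice_natCast, put_self]

lemma slice_of_neg_right (P : MvPolynomial (Fin n) ℤ) (p : ℤ) {q : ℤ} (hq : q < 0) :
    slice T c i j P p q = 0 := if_neg (by omega)

lemma slice_sub (P Q : MvPolynomial (Fin n) ℤ) (p q : ℤ) :
    slice T c i j (P - Q) p q = slice T c i j P p q - slice T c i j Q p q := by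
  unfold slice
  split_ifs <;> simp

lemma slice_X_mul_left (hT : IsShiftFamily T) (hij : i ≠ j) (P : MvPolynomial (Fin n) ℤ)
    (p q : ℤ) : slice T c i j (X i * P) p q = slice T c i j P (p - 1) q := by
  unfold slice
  rw [hT.X_mul, put_sub_single_left c hij, put_apply c hij, if_pos rfl]
  by_cases h : 1 ≤ p
  · have h1 : (p - 1).toNat = p.toNat - 1 := by omega
    rw [h1]
    split_ifs <;> first | rfl | omega
  · split_ifs <;> first | rfl | omega

lemma slice_X_mul_right (hT : IsShiftFamily T) (hij : i ≠ j) (P : MvPolynomial (Fin n) ℤ)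
    (p q : ℤ) : slice T c i j (X j * P) p q = slice T c i j P p (q - 1) := by
  unfold slice
  rw [hT.X_mul, put_sub_single_right c hij, put_apply c hij, if_neg hij.symm, if_pos rfl]
  by_cases h : 1 ≤ q
  · have h1 : (q - 1).toNat = q.toNat - 1 := by omega
    rw [h1]
    split_ifs <;> first | rfl | omega
  · split_ifs <;> first | rfl | omega

lemma slice_rename_swap (hT : IsShiftFamily T) (hij : i ≠ j) (P : MvPolynomial (Fin n) ℤ)
    (p q : ℤ) : slice T c i j (rename (Equiv.swap i j) P) p q = slice T c i j P q p := by
  unfold slice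
  rw [hT.rename_swap, mapDomain_put c hij]
  simp only [and_comm]

lemma slice_sub_of_mul_eq (hT : IsShiftFamily T) (hij : i ≠ j) {A B : MvPolynomial (Fin n) ℤ}
    (h : (X i - X j) * A = B - rename (Equiv.swap i j) B) (p q : ℤ) :
    slice T c i j A (p - 1) q - slice T c i j A p (q - 1) =
      slice T c i j B p q - slice T c i j B q p := by
  have := congrArg (fun P => slice T c i j P p q) h
  simpa only [sub_mul, slice_sub, slice_X_mul_left c hT hij, slice_X_mul_right c hT hij,
    slice_rename_swap c hT hij] using this

end slice

lemma eq_zero_of_antidiagonal_eq {E : ℤ → ℤ → ℤ} (hE : ∀ p q, E (p - 1) q = E p (q - 1))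
    (h0 : ∀ p q, q < 0 → E p q = 0) (p q : ℤ) : E p q = 0 := by
  rcases lt_or_ge q 0 with hq | hq
  · exact h0 p q hq
  lift q to ℕ using hq
  induction q generalizing p with
  | zero =>
    have := hE (p + 1) 0
    rw [add_sub_cancel_right] at this
    push_cast
    rw [this]
    exact h0 _ _ (by norm_num)
  | succ q ih =>
    have := hE (p + 1) ((q + 1 : ℕ) : ℤ)
    rw [add_sub_cancel_right] at this
    rw [this]
    have h2 : ((q + 1 : ℕ) : ℤ) - 1 = q := by push_cast; ring
    rw [h2]
    exact ih _

/-- The sum of the entries of `b` over `S`. -/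
def wt {n : ℕ} (b : Fin n →₀ ℕ) (S : Finset (Fin n)) : ℤ := ∑ k ∈ S, (b k : ℤ)

lemma wt_union_add_wt_inter {n : ℕ} (b : Fin n →₀ ℕ) (S T : Finset (Fin n)) :
    wt b (S ∪ T) + wt b (S ∩ T) = wt b S + wt b T :=
  Finset.sum_union_inter

lemma wt_empty {n : ℕ} (b : Fin n →₀ ℕ) : wt b ∅ = 0 := Finset.sum_empty

lemma wt_mono {n : ℕ} {b c : Fin n →₀ ℕ} (h : b ≤ c) (S : Finset (Fin n)) : wt b S ≤ wt c S :=
  Finset.sum_le_sum fun k _ => Nat.cast_le.2 (h k)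

lemma wt_insert {n : ℕ} (b : Fin n →₀ ℕ) {S : Finset (Fin n)} {k : Fin n} (h : k ∉ S) :
    wt b (insert k S) = b k + wt b S :=
  Finset.sum_insert h

lemma wt_nonneg {n : ℕ} (b : Fin n →₀ ℕ) (S : Finset (Fin n)) : 0 ≤ wt b S :=
  Finset.sum_nonneg fun _ _ => Nat.cast_nonneg _

lemma wt_sub_single {n : ℕ} (b : Fin n →₀ ℕ) {k : Fin n} (h : b k ≠ 0) (S : Finset (Fin n)) :
    wt (b - Finsupp.single k 1) S = wt b S - if k ∈ S then 1 else 0 := by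
  have h1 : ∀ m, (((b - Finsupp.single k 1 : Fin n →₀ ℕ) m : ℕ) : ℤ) = b m - if m = k then 1 else 0 := by
    intro m
    rw [Finsupp.tsub_apply]
    rcases eq_or_ne m k with rfl | hm
    · simp; omega
    · simp [hm]
  simp only [wt, h1, Finset.sum_sub_distrib, Finset.sum_ite_eq']

/-- Normalized nonnegative supermodular set functions. -/
structure IsSupermodular {n : ℕ} (f : Finset (Fin n) → ℤ) : Prop where
  empty : f ∅ = 0
  nonneg : ∀ S, 0 ≤ f S
  add_le : ∀ S T, f S + f T ≤ f (S ∪ T) + f (S ∩ T)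

/-- The lattice points of the contrapolymatroid of `f`. -/
def upset {n : ℕ} (f : Finset (Fin n) → ℤ) : Set (Fin n →₀ ℕ) := {b | ∀ S, f S ≤ wt b S}

lemma exists_le_minimal_on {n : ℕ} (Q : (Fin n →₀ ℕ) → Prop) (A : Finset (Fin n))
    (b : Fin n →₀ ℕ) (hb : Q b) : ∃ b' ≤ b, Q b' ∧ (∀ k ∉ A, b' k = b k) ∧
      ∀ k ∈ A, b' k = 0 ∨ ¬ Q (b' - Finsupp.single k 1) := by
  induction hN : ∑ k, b k using Nat.strong_induction_on generalizing b with
  | _ N ih =>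
  by_cases h : ∃ k ∈ A, b k ≠ 0 ∧ Q (b - Finsupp.single k 1)
  · obtain ⟨k, hkA, hk, hQ⟩ := h
    have hlt : ∑ m, (b - Finsupp.single k 1 : Fin n →₀ ℕ) m < N := by
      rw [← hN]
      refine Finset.sum_lt_sum (fun m _ => by simp) ⟨k, Finset.mem_univ k, ?_⟩
      simp; omega
    obtain ⟨b', h1, h2, h3, h4⟩ := ih _ hlt _ hQ rfl
    refine ⟨b', h1.trans tsub_le_self, h2, fun m hm => ?_, h4⟩
    have hmk : k ≠ m := by rintro rfl; exact hm hkA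
    rw [h3 m hm]
    simp [hmk]
  · push Not at h
    refine ⟨b, le_rfl, hb, fun _ _ => rfl, fun k hk => ?_⟩
    by_cases h0 : b k = 0
    · exact Or.inl h0
    · exact Or.inr (h k hk h0)

lemma exists_superset_of_forall_exists_insert {α : Type*} [DecidableEq α] (P : Finset α → Prop)
    {T₀ : Finset α} (h0 : P T₀) (A : Finset α)
    (h : ∀ k ∈ A, ∀ T, P T → ∃ T', P T' ∧ insert k T ⊆ T') : ∃ T, P T ∧ A ⊆ T := by
  induction A using Finset.induction_on with
  | empty => exact ⟨T₀, h0, Finset.empty_subset _⟩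
  | insert k A hk ih =>
    obtain ⟨T, hT, hAT⟩ := ih fun m hm => h m (Finset.mem_insert_of_mem hm)
    obtain ⟨T', hT', hsub⟩ := h k (Finset.mem_insert_self _ _) T hT
    refine ⟨T', hT', fun m hm => hsub ?_⟩
    rcases Finset.mem_insert.1 hm with rfl | hm
    · exact Finset.mem_insert_self _ _
    · exact Finset.mem_insert_of_mem (hAT hm)

namespace IsSupermodular

variable {n : ℕ} {f : Finset (Fin n) → ℤ}

lemma tight_union (hf : IsSupermodular f) {b : Fin n →₀ ℕ} (hb : b ∈ upset f)
    {S T : Finset (Fin n)} (hS : f S = wt b S) (hT : f T = wt b T) :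
    f (S ∪ T) = wt b (S ∪ T) := by
  have h1 := hf.add_le S T
  have h2 := wt_union_add_wt_inter b S T
  have h3 := hb (S ∪ T)
  have h4 := hb (S ∩ T)
  omega

lemma exists_tight (hf : IsSupermodular f) {b : Fin n →₀ ℕ} (hb : b ∈ upset f) {k : Fin n}
    (h : b k = 0 ∨ b - Finsupp.single k 1 ∉ upset f) : ∃ S, k ∈ S ∧ f S = wt b S := by
  by_cases h0 : b k = 0
  · refine ⟨{k}, Finset.mem_singleton_self k, le_antisymm (hb _) ?_⟩
    simpa [wt, h0] using hf.nonneg {k}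
  · have h1 := h.resolve_left h0
    simp only [upset, Set.mem_ofPred_eq, not_forall, not_le] at h1
    obtain ⟨S, hS⟩ := h1
    rw [wt_sub_single b h0] at hS
    have := hb S
    split_ifs at hS with hk
    · exact ⟨S, hk, by omega⟩
    · omega

lemma exists_le_tight_superset (hf : IsSupermodular f) (A : Finset (Fin n)) {b : Fin n →₀ ℕ}
    (hb : b ∈ upset f) : ∃ b' ≤ b, b' ∈ upset f ∧ (∀ k ∉ A, b' k = b k) ∧
      ∃ T, f T = wt b' T ∧ A ⊆ T := by
  obtain ⟨b', h1, h2, h3, h4⟩ := exists_le_minimal_on (· ∈ upset f) A b hb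
  refine ⟨b', h1, h2, h3, exists_superset_of_forall_exists_insert _
    (T₀ := ∅) (by rw [hf.empty, wt_empty]) A fun k hk T hT => ?_⟩
  obtain ⟨S, hkS, hS⟩ := hf.exists_tight h2 (h4 k hk)
  exact ⟨S ∪ T, hf.tight_union h2 hS hT, Finset.insert_subset
    (Finset.mem_union_left _ hkS) Finset.subset_union_right⟩

/-- Every point of the contrapolymatroid dominates one of minimal total degree. -/
lemma exists_le_base (hf : IsSupermodular f) {b : Fin n →₀ ℕ} (hb : b ∈ upset f) :
    ∃ b' ≤ b, b' ∈ upset f ∧ f Finset.univ = wt b' Finset.univ := by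
  obtain ⟨b', h1, h2, -, T, hT, hsub⟩ := hf.exists_le_tight_superset Finset.univ hb
  rw [Finset.univ_subset_iff.1 hsub] at hT
  exact ⟨b', h1, h2, hT⟩

/-- Every value of `f` is attained by some point of the contrapolymatroid. -/
lemma exists_mem_tight (hf : IsSupermodular f) (A : Finset (Fin n)) :
    ∃ b ∈ upset f, f A = wt b A := by
  obtain ⟨M, hM⟩ : ∃ M : ℕ, ∀ S, f S < M := by
    refine ⟨(∑ S, f S).toNat + 1, fun S => ?_⟩
    have := Finset.single_le_sum (fun S _ => hf.nonneg S) (Finset.mem_univ S)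
    omega
  have hlarge : ∀ (b : Fin n →₀ ℕ) (S : Finset (Fin n)) (k : Fin n), k ∈ S → b k = M →
      f S < wt b S := by
    intro b S k hk hbk
    have h1 : ((b k : ℕ) : ℤ) ≤ wt b S :=
      Finset.single_le_sum (f := fun k => (b k : ℤ)) (fun _ _ => Nat.cast_nonneg _) hk
    have := hM S
    omega
  let b₀ : Fin n →₀ ℕ := Finsupp.equivFunOnFinite.symm fun _ => M
  have hb₀ : b₀ ∈ upset f := by
    intro S
    rcases S.eq_empty_or_nonempty with rfl | ⟨k, hk⟩
    · rw [hf.empty, wt_empty]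
    · exact (hlarge b₀ S k hk rfl).le
  obtain ⟨b, -, h2, h3, T, hT, hAT⟩ := hf.exists_le_tight_superset A hb₀
  refine ⟨b, h2, ?_⟩
  have hTA : T ⊆ A := by
    intro k hk
    by_contra hkA
    have := hlarge b T k hk (h3 k hkA)
    omega
  rwa [hTA.antisymm hAT] at hT

end IsSupermodular

section put

variable {n : ℕ} (c : Fin n →₀ ℕ) {i j : Fin n}

lemma wt_put (hij : i ≠ j) (p q : ℕ) {S : Finset (Fin n)} (hi : i ∉ S) (hj : j ∉ S) :
    wt (put c i j p q) S = wt c S := by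
  refine Finset.sum_congr rfl fun k hk => ?_
  rw [put_apply c hij, if_neg (by rintro rfl; exact hi hk), if_neg (by rintro rfl; exact hj hk)]

lemma wt_put_insert_left (hij : i ≠ j) (p q : ℕ) {S : Finset (Fin n)} (hi : i ∉ S) (hj : j ∉ S) :
    wt (put c i j p q) (insert i S) = p + wt c S := by
  rw [wt_insert _ hi, wt_put c hij p q hi hj, put_apply c hij, if_pos rfl]

lemma wt_put_insert_right (hij : i ≠ j) (p q : ℕ) {S : Finset (Fin n)} (hi : i ∉ S)
    (hj : j ∉ S) : wt (put c i j p q) (insert j S) = q + wt c S := by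
  rw [wt_insert _ hj, wt_put c hij p q hi hj, put_apply c hij, if_neg hij.symm, if_pos rfl]

lemma wt_put_insert_insert (hij : i ≠ j) (p q : ℕ) {S : Finset (Fin n)} (hi : i ∉ S)
    (hj : j ∉ S) : wt (put c i j p q) (insert i (insert j S)) = p + q + wt c S := by
  rw [wt_insert _ (by simp [hij, hi]), wt_put_insert_right c hij p q hi hj, put_apply c hij,
    if_pos rfl, add_assoc]

end put

lemma forall_finset_iff {α : Type*} [DecidableEq α] (i j : α) (Q : Finset α → Prop) :
    (∀ S, Q S) ↔ ∀ S, i ∉ S → j ∉ S →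
      Q S ∧ Q (insert i S) ∧ Q (insert j S) ∧ Q (insert i (insert j S)) := by
  refine ⟨fun h S _ _ => ⟨h _, h _, h _, h _⟩, fun h S => ?_⟩
  have h1 := h ((S.erase i).erase j) (by simp) (by simp)
  by_cases hi : i ∈ S <;> by_cases hj : j ∈ S
  · convert h1.2.2.2 using 1
    ext m; simp; grind
  · convert h1.2.1 using 1
    ext m; simp; grind
  · convert h1.2.2.1 using 1
    ext m; simp; grind
  · convert h1.1 using 1
    ext m; simp; grind

/-- The constants describing the points of the contrapolymatroid of `f` that agree with `c`
outside `i` and `j`. -/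
structure IsSlice {n : ℕ} (f : Finset (Fin n) → ℤ) (i j : Fin n) (c : Fin n →₀ ℕ)
    (α β γ : ℤ) : Prop where
  le : ∀ S, i ∉ S → j ∉ S → f S ≤ wt c S ∧ f (insert i S) ≤ α + wt c S ∧
    f (insert j S) ≤ β + wt c S ∧ f (insert i (insert j S)) ≤ γ + wt c S
  exists_left : ∃ S, i ∉ S ∧ j ∉ S ∧ f (insert i S) = α + wt c S
  exists_right : ∃ S, i ∉ S ∧ j ∉ S ∧ f (insert j S) = β + wt c S
  exists_both : ∃ S, i ∉ S ∧ j ∉ S ∧ f (insert i (insert j S)) = γ + wt c S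

lemma exists_isSlice {n : ℕ} (f : Finset (Fin n) → ℤ) (i j : Fin n) (c : Fin n →₀ ℕ)
    (hc : ∀ S, i ∉ S → j ∉ S → f S ≤ wt c S) : ∃ α β γ, IsSlice f i j c α β γ := by
  have key : ∀ h : Finset (Fin n) → ℤ, ∃ a, (∀ S, i ∉ S → j ∉ S → h S ≤ a + wt c S) ∧
      ∃ S, i ∉ S ∧ j ∉ S ∧ h S = a + wt c S := by
    intro h
    obtain ⟨S, hS, hmax⟩ := Finset.exists_max_image
      (Finset.univ.filter fun S : Finset (Fin n) => i ∉ S ∧ j ∉ S) (fun S => h S - wt c S)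
      ⟨∅, by simp⟩
    simp only [Finset.mem_filter, Finset.mem_univ, true_and] at hS hmax
    refine ⟨h S - wt c S, fun S' h1 h2 => ?_, S, hS.1, hS.2, by ring⟩
    have := hmax S' ⟨h1, h2⟩
    omega
  obtain ⟨α, h1, h1'⟩ := key fun S => f (insert i S)
  obtain ⟨β, h2, h2'⟩ := key fun S => f (insert j S)
  obtain ⟨γ, h3, h3'⟩ := key fun S => f (insert i (insert j S))
  exact ⟨α, β, γ, fun S hi hj => ⟨hc S hi hj, h1 S hi hj, h2 S hi hj, h3 S hi hj⟩, h1', h2', h3'⟩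

namespace IsSlice

variable {n : ℕ} {f : Finset (Fin n) → ℤ} {i j : Fin n} {c : Fin n →₀ ℕ} {α β γ : ℤ}

lemma put_mem_upset_iff (h : IsSlice f i j c α β γ) (hij : i ≠ j) (p q : ℕ) :
    put c i j p q ∈ upset f ↔ α ≤ p ∧ β ≤ q ∧ γ ≤ p + q := by
  rw [upset, Set.mem_ofPred_eq, forall_finset_iff i j]
  constructor
  · intro hS
    obtain ⟨S₁, hi₁, hj₁, h₁⟩ := h.exists_left
    obtain ⟨S₂, hi₂, hj₂, h₂⟩ := h.exists_right
    obtain ⟨S₃, hi₃, hj₃, h₃⟩ := h.exists_both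
    have e1 := (hS S₁ hi₁ hj₁).2.1
    have e2 := (hS S₂ hi₂ hj₂).2.2.1
    have e3 := (hS S₃ hi₃ hj₃).2.2.2
    rw [wt_put_insert_left c hij p q hi₁ hj₁] at e1
    rw [wt_put_insert_right c hij p q hi₂ hj₂] at e2
    rw [wt_put_insert_insert c hij p q hi₃ hj₃] at e3
    omega
  · intro hpq S hi hj
    have := h.le S hi hj
    rw [wt_put c hij p q hi hj, wt_put_insert_left c hij p q hi hj,
      wt_put_insert_right c hij p q hi hj, wt_put_insert_insert c hij p q hi hj]
    omega

lemma nonneg_left (h : IsSlice f i j c α β γ) (hf : IsSupermodular f) : 0 ≤ α := by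
  have h1 := (h.le ∅ (by simp) (by simp)).2.1
  have h2 := hf.nonneg (insert i ∅)
  rw [wt_empty] at h1
  omega

lemma nonneg_right (h : IsSlice f i j c α β γ) (hf : IsSupermodular f) : 0 ≤ β := by
  have h1 := (h.le ∅ (by simp) (by simp)).2.2.1
  have h2 := hf.nonneg (insert j ∅)
  rw [wt_empty] at h1
  omega

lemma add_le (h : IsSlice f i j c α β γ) (hf : IsSupermodular f) (hij : i ≠ j) :
    α + β ≤ γ := by
  obtain ⟨S₁, hi₁, hj₁, h₁⟩ := h.exists_left
  obtain ⟨S₂, hi₂, hj₂, h₂⟩ := h.exists_right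
  have h3 := hf.add_le (insert i S₁) (insert j S₂)
  have e1 : insert i S₁ ∪ insert j S₂ = insert i (insert j (S₁ ∪ S₂)) := by
    ext m; simp; grind
  have e2 : insert i S₁ ∩ insert j S₂ = S₁ ∩ S₂ := by
    ext m; simp; grind
  rw [e1, e2] at h3
  have h4 := (h.le (S₁ ∪ S₂) (by simp [hi₁, hi₂]) (by simp [hj₁, hj₂])).2.2.2
  have h5 := (h.le (S₁ ∩ S₂) (by simp [hi₁]) (by simp [hj₁])).1
  have h6 := wt_union_add_wt_inter c S₁ S₂
  omega

end IsSlice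

/-- `P` is the sum of the monomials of minimal total degree in the contrapolymatroid of `f`, and
the coefficient sums of `Q` form the indicator function of that contrapolymatroid. -/
structure IsRepresentedBy {n : ℕ} (f : Finset (Fin n) → ℤ) (P Q : MvPolynomial (Fin n) ℤ) :
    Prop where
  supermodular : IsSupermodular f
  coeff_eq : ∀ a, coeff a P = if a ∈ upset f ∧ wt a Finset.univ = f Finset.univ then 1 else 0
  coeffSum_eq : ∀ b, coeffSum b Q = if b ∈ upset f then 1 else 0

lemma slice_dichotomy {α β γ : ℤ} {A B : ℤ → ℤ → ℤ}
    (hγ : α + β ≤ γ) (hB : ∀ p q, B p q = if α ≤ p ∧ β ≤ q ∧ p + q = γ then 1 else 0)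
    (hrel : ∀ p q, A (p - 1) q - A p (q - 1) = B p q - B q p)
    (hsymm : ∀ p q, A p q = A q p) (hneg : ∀ p q, q < 0 → A p q = 0) (hone : ∀ p q, A p q ≤ 1)
    (hle : ∀ p q, B p q ≤ A (p - 1) q) : β + 1 ≤ α ∧ (α = β + 1 ∨ γ = α + β) := by
  obtain ⟨g, hg⟩ : ∃ g : ℤ → ℤ, ∀ p, g p = A p (γ - 1 - p) := ⟨_, fun _ => rfl⟩
  have hgrel : ∀ p, g (p - 1) - g p = B p (γ - p) - B (γ - p) p := by
    intro p
    rw [← hrel, hg, hg]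
    congr 2 <;> ring
  have hgzero : ∀ p₀, (∀ p, p₀ < p → B p (γ - p) = B (γ - p) p) → g p₀ = 0 := by
    intro p₀ h
    have hconst : ∀ d : ℕ, g (p₀ + d) = g p₀ := by
      intro d
      induction d with
      | zero => simp
      | succ d ih =>
        have h1 := hgrel (p₀ + d + 1)
        have h2 := h (p₀ + d + 1) (by omega)
        rw [h2, add_sub_cancel_right] at h1
        push_cast
        rw [← add_assoc]
        omega
    rw [← hconst (γ - p₀).toNat, hg]
    exact hneg _ _ (by omega)
  have hlt : β + 1 ≤ α := by
    by_contra hcon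
    have h1 := hle α (γ - α)
    rw [hB, if_pos (by omega)] at h1
    have h2 := hgzero (γ - α) fun p hp => by
      rw [hB, hB, if_neg (by omega), if_neg (by omega)]
    rw [hg, hsymm, show γ - 1 - (γ - α) = α - 1 by ring] at h2
    omega
  refine ⟨hlt, ?_⟩
  by_contra hcon
  have h1 := hgzero (γ - β) fun p hp => by
    rw [hB, hB, if_neg (by omega), if_neg (by omega)]
  have h2 := hgrel (γ - β)
  rw [hB, hB, if_pos (by omega), if_neg (by omega)] at h2
  have h3 := hgrel (γ - β - 1)
  rw [hB, hB, if_pos (by omega), if_neg (by omega)] at h3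
  have h4 := hone (γ - β - 1 - 1) (γ - 1 - (γ - β - 1 - 1))
  rw [← hg] at h4
  omega

lemma insert_insert_erase_erase {n : ℕ} {i j : Fin n} (hij : i ≠ j) :
    insert i (insert j ((Finset.univ.erase i).erase j)) = Finset.univ := by
  rw [Finset.insert_erase (by simp [hij.symm]), Finset.insert_erase (Finset.mem_univ _)]

lemma slice_coeff_eq {n : ℕ} {f : Finset (Fin n) → ℤ} {P Q : MvPolynomial (Fin n) ℤ}
    (hP : IsRepresentedBy f P Q) {i j : Fin n} (hij : i ≠ j) {c : Fin n →₀ ℕ} {α β γ : ℤ}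
    (h : IsSlice f i j c α β γ) (p q : ℤ) :
    slice (lcoeff ℤ) c i j P p q = if α ≤ p ∧ β ≤ q ∧ γ ≤ p + q ∧
      p + q + wt c ((Finset.univ.erase i).erase j) = f Finset.univ then 1 else 0 := by
  have hα := h.nonneg_left hP.supermodular
  have hβ := h.nonneg_right hP.supermodular
  by_cases hpq : 0 ≤ p ∧ 0 ≤ q
  · obtain ⟨hp, hq⟩ := hpq
    lift p to ℕ using hp
    lift q to ℕ using hq
    have hw := wt_put_insert_insert c hij p q (S := (Finset.univ.erase i).erase j)
      (by simp) (by simp)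
    rw [insert_insert_erase_erase hij] at hw
    rw [slice_natCast, lcoeff_apply, hP.coeff_eq, h.put_mem_upset_iff hij, hw]
    simp only [and_assoc]
  · rw [slice, if_neg hpq, if_neg (by omega)]

lemma slice_coeffSum_eq {n : ℕ} {f : Finset (Fin n) → ℤ} {P Q : MvPolynomial (Fin n) ℤ}
    (hP : IsRepresentedBy f P Q) {i j : Fin n} (hij : i ≠ j) {c : Fin n →₀ ℕ} {α β γ : ℤ}
    (h : IsSlice f i j c α β γ) (p q : ℤ) :
    slice coeffSum c i j Q p q = if α ≤ p ∧ β ≤ q ∧ γ ≤ p + q then 1 else 0 := by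
  have hα := h.nonneg_left hP.supermodular
  have hβ := h.nonneg_right hP.supermodular
  by_cases hpq : 0 ≤ p ∧ 0 ≤ q
  · obtain ⟨hp, hq⟩ := hpq
    lift p to ℕ using hp
    lift q to ℕ using hq
    rw [slice_natCast, hP.coeffSum_eq, h.put_mem_upset_iff hij]
    split_ifs <;> rfl
  · rw [slice, if_neg hpq, if_neg (by omega)]

lemma put_sub_single_of_ne {n : ℕ} (c : Fin n →₀ ℕ) {i j k : Fin n} (hij : i ≠ j) (hi : k ≠ i)
    (hj : k ≠ j) (p q : ℕ) :
    put (c - Finsupp.single k 1) i j p q = put c i j p q - Finsupp.single k 1 := by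
  ext m
  rw [Finsupp.tsub_apply, put_apply _ hij, put_apply _ hij, Finsupp.tsub_apply,
    Finsupp.single_apply]
  split_ifs <;> simp_all

lemma IsSlice.dichotomy {n : ℕ} {f : Finset (Fin n) → ℤ} {P Q A : MvPolynomial (Fin n) ℤ}
    (hP : IsRepresentedBy f P Q) {i j : Fin n} (hij : i ≠ j)
    (hrel : (X i - X j) * A = P - rename (Equiv.swap i j) P)
    (hsymm : rename (Equiv.swap i j) A = A) (hone : ∀ a, coeff a A ≤ 1)
    (hle : ∀ a, coeff a P ≤ coeff a (X i * A)) {c : Fin n →₀ ℕ} {α β γ : ℤ}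
    (h : IsSlice f i j c α β γ) : β + 1 ≤ α ∧ (α = β + 1 ∨ γ = α + β) := by
  have hf := hP.supermodular
  have hα := h.nonneg_left hf
  have hβ := h.nonneg_right hf
  have hγ := h.add_le hf hij
  have hT := isShiftFamily_lcoeff n
  obtain ⟨c', hcc, ⟨hb1, hb2⟩, -, hmin⟩ := exists_le_minimal_on
    (fun c => put c i j α.toNat (γ - α).toNat ∈ upset f ∧ put c i j (γ - β).toNat β.toNat ∈ upset f)
    ((Finset.univ.erase i).erase j) c
    ⟨(h.put_mem_upset_iff hij _ _).2 (by omega), (h.put_mem_upset_iff hij _ _).2 (by omega)⟩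
  obtain ⟨α', β', γ', h'⟩ := exists_isSlice f i j c' fun S hi hj => by
    have := hb1 S
    rwa [wt_put c' hij _ _ hi hj] at this
  have e1 := (h'.put_mem_upset_iff hij _ _).1 hb1
  have e2 := (h'.put_mem_upset_iff hij _ _).1 hb2
  have hα' : α' = α := by
    obtain ⟨S, hi, hj, hS⟩ := h.exists_left
    have := (h'.le S hi hj).2.1
    have := wt_mono hcc S
    omega
  have hβ' : β' = β := by
    obtain ⟨S, hi, hj, hS⟩ := h.exists_right
    have := (h'.le S hi hj).2.2.1
    have := wt_mono hcc S
    omega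
  have hγ' : γ' = γ := by
    obtain ⟨S, hi, hj, hS⟩ := h.exists_both
    have := (h'.le S hi hj).2.2.2
    have := wt_mono hcc S
    omega
  rw [hα', hβ', hγ'] at h'
  have htop : ∀ T, i ∈ T → j ∈ T → ∀ p q : ℕ,
      wt (put c' i j p q) T = p + q + wt c' ((T.erase i).erase j) := by
    intro T hi hj p q
    rw [← wt_put_insert_insert c' hij p q (S := (T.erase i).erase j) (by simp) (by simp),
      Finset.insert_erase (by simp [hij.symm, hj]), Finset.insert_erase hi]
  obtain ⟨T, ⟨hiT, hjT, hTt⟩, hsub⟩ := exists_superset_of_forall_exists_insert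
    (fun T => i ∈ T ∧ j ∈ T ∧ f T = wt (put c' i j α.toNat (γ - α).toNat) T)
    (T₀ := insert i (insert j h'.exists_both.choose)) ⟨by simp, by simp, by
      obtain ⟨hi, hj, hS⟩ := h'.exists_both.choose_spec
      rw [wt_put_insert_insert c' hij _ _ hi hj, hS]
      omega⟩ ((Finset.univ.erase i).erase j) (fun k hk T ⟨hi, hj, hT⟩ => by
      simp only [Finset.mem_erase, Finset.mem_univ, and_true] at hk
      have hT2 : f T = wt (put c' i j (γ - β).toNat β.toNat) T := by
        rw [hT, htop T hi hj, htop T hi hj]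
        omega
      have hk' := hmin k (by simp [hk])
      rw [put_sub_single_of_ne c' hij hk.2 hk.1, put_sub_single_of_ne c' hij hk.2 hk.1,
        not_and_or] at hk'
      have hput : ∀ p q, put c' i j p q k = c' k := fun p q => by
        rw [put_apply c' hij, if_neg hk.2, if_neg hk.1]
      have hfin : ∀ S, k ∈ S → i ∈ S ∪ T ∧ j ∈ S ∪ T ∧ insert k T ⊆ S ∪ T := fun S hS =>
        ⟨Finset.mem_union_right _ hi, Finset.mem_union_right _ hj, Finset.insert_subset
          (Finset.mem_union_left _ hS) Finset.subset_union_right⟩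
      have hcase : (put c' i j α.toNat (γ - α).toNat k = 0 ∨
          put c' i j α.toNat (γ - α).toNat - Finsupp.single k 1 ∉ upset f) ∨
          (put c' i j (γ - β).toNat β.toNat k = 0 ∨
          put c' i j (γ - β).toNat β.toNat - Finsupp.single k 1 ∉ upset f) := by
        rw [hput, hput]
        tauto
      rcases hcase with hc | hc
      · obtain ⟨S, hkS, hS⟩ := hf.exists_tight hb1 hc
        obtain ⟨h1, h2, h3⟩ := hfin S hkS
        exact ⟨S ∪ T, ⟨h1, h2, hf.tight_union hb1 hS hT⟩, h3⟩
      · obtain ⟨S, hkS, hS⟩ := hf.exists_tight hb2 hc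
        obtain ⟨h1, h2, h3⟩ := hfin S hkS
        refine ⟨S ∪ T, ⟨h1, h2, ?_⟩, h3⟩
        have := hf.tight_union hb2 hS hT2
        rw [htop _ h1 h2] at this ⊢
        omega)
  have hTu : T = Finset.univ := by
    refine Finset.univ_subset_iff.1 ?_
    rw [← insert_insert_erase_erase hij]
    exact Finset.insert_subset hiT (Finset.insert_subset hjT hsub)
  rw [hTu, htop _ (Finset.mem_univ _) (Finset.mem_univ _)] at hTt
  refine slice_dichotomy (A := slice (lcoeff ℤ) c' i j A) (B := slice (lcoeff ℤ) c' i j P)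
    hγ (fun p q => ?_) (slice_sub_of_mul_eq c' hT hij hrel) (fun p q => ?_)
    (fun p q hq => slice_of_neg_right c' A p hq) (fun p q => ?_) (fun p q => ?_)
  · rw [slice_coeff_eq hP hij h']
    congr 1
    rw [eq_iff_iff]
    omega
  · rw [← slice_rename_swap c' hT hij, hsymm]
  · unfold slice
    split_ifs
    · exact hone _
    · norm_num
  · rw [← slice_X_mul_left c' hT hij]
    unfold slice
    split_ifs
    · exact hle _
    · exact le_rfl

/-- The set function representing `S w`, obtained from the one representing `S (w * swap i j)`
for an ascent `i, j` of `w`. -/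
def symmetrize {n : ℕ} (f : Finset (Fin n) → ℤ) (i j : Fin n) (S : Finset (Fin n)) : ℤ :=
  if i ∈ S ∧ j ∈ S then f (insert i (insert j ((S.erase i).erase j))) - 1
  else if i ∈ S ∨ j ∈ S then f (insert j ((S.erase i).erase j)) else f ((S.erase i).erase j)

section symmetrize

variable {n : ℕ} (f : Finset (Fin n) → ℤ) {i j : Fin n} {S : Finset (Fin n)}

lemma erase_erase_eq_self (hi : i ∉ S) (hj : j ∉ S) : (S.erase i).erase j = S := by
  rw [Finset.erase_eq_of_notMem hi, Finset.erase_eq_of_notMem hj]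

lemma symmetrize_of_notMem (hi : i ∉ S) (hj : j ∉ S) : symmetrize f i j S = f S := by
  rw [symmetrize, erase_erase_eq_self hi hj, if_neg (by tauto), if_neg (by tauto)]

lemma symmetrize_insert_left (hij : i ≠ j) (hi : i ∉ S) (hj : j ∉ S) :
    symmetrize f i j (insert i S) = f (insert j S) := by
  rw [symmetrize, Finset.erase_insert hi, Finset.erase_eq_of_notMem hj,
    if_neg (by simp [hij.symm, hj]), if_pos (by simp)]

lemma symmetrize_insert_right (hij : i ≠ j) (hi : i ∉ S) (hj : j ∉ S) :
    symmetrize f i j (insert j S) = f (insert j S) := by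
  rw [symmetrize, Finset.erase_eq_of_notMem (s := insert j S) (by simp [hij, hi]),
    Finset.erase_insert hj, if_neg (by simp [hij, hi]), if_pos (by simp)]

lemma symmetrize_insert_insert (hij : i ≠ j) (hi : i ∉ S) (hj : j ∉ S) :
    symmetrize f i j (insert i (insert j S)) = f (insert i (insert j S)) - 1 := by
  rw [symmetrize, Finset.erase_insert (by simp [hij, hi]), Finset.erase_insert hj,
    if_pos (by simp)]

variable {f}

lemma isSupermodular_symmetrize (hf : IsSupermodular f) (hij : i ≠ j)
    (hlt : ∀ S, i ∉ S → j ∉ S → f (insert j S) + 1 ≤ f (insert i S)) :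
    IsSupermodular (symmetrize f i j) where
  empty := by rw [symmetrize_of_notMem f (by simp) (by simp), hf.empty]
  nonneg := by
    rw [forall_finset_iff i j]
    intro S hi hj
    rw [symmetrize_of_notMem f hi hj, symmetrize_insert_left f hij hi hj,
      symmetrize_insert_right f hij hi hj, symmetrize_insert_insert f hij hi hj]
    refine ⟨hf.nonneg _, hf.nonneg _, hf.nonneg _, ?_⟩
    have h1 := hlt S hi hj
    have h2 := hf.nonneg (insert j S)
    have h3 := hf.add_le (insert i S) {j}
    have e1 : insert i S ∪ {j} = insert i (insert j S) := by grind
    have e2 : insert i S ∩ {j} = ∅ := by grind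
    have h4 := hf.nonneg {j}
    rw [e1, e2, hf.empty] at h3
    omega
  add_le := by
    intro A B
    have hsup : ∀ A B C D, A ∪ B = C → A ∩ B = D → f A + f B ≤ f C + f D := by
      rintro A B _ _ rfl rfl
      exact hf.add_le A B
    unfold symmetrize
    have e1 : ((A ∪ B).erase i).erase j = (A.erase i).erase j ∪ (B.erase i).erase j := by
      ext m; simp; tauto
    have e2 : ((A ∩ B).erase i).erase j = (A.erase i).erase j ∩ (B.erase i).erase j := by
      ext m; simp; tauto
    rw [e1, e2]
    have hiS : i ∉ (A.erase i).erase j := by simp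
    have hjS : j ∉ (A.erase i).erase j := by simp
    have hiT : i ∉ (B.erase i).erase j := by simp
    have hjT : j ∉ (B.erase i).erase j := by simp
    generalize (A.erase i).erase j = S at *
    generalize (B.erase i).erase j = T at *
    have k1 := hf.add_le S T
    have k2 := hsup S (insert j T) (insert j (S ∪ T)) (S ∩ T) (by grind) (by grind)
    have k3 := hsup (insert j S) T (insert j (S ∪ T)) (S ∩ T) (by grind) (by grind)
    have k4 := hsup S (insert i (insert j T)) (insert i (insert j (S ∪ T))) (S ∩ T)
      (by grind) (by grind)
    have k5 := hsup (insert i (insert j S)) T (insert i (insert j (S ∪ T))) (S ∩ T)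
      (by grind) (by grind)
    have k6 := hsup (insert j S) (insert j T) (insert j (S ∪ T)) (insert j (S ∩ T))
      (by grind) (by grind)
    have k7 := hsup (insert j S) (insert i (insert j T)) (insert i (insert j (S ∪ T)))
      (insert j (S ∩ T)) (by grind) (by grind)
    have k8 := hsup (insert i (insert j S)) (insert j T) (insert i (insert j (S ∪ T)))
      (insert j (S ∩ T)) (by grind) (by grind)
    have k9 := hsup (insert i (insert j S)) (insert i (insert j T))
      (insert i (insert j (S ∪ T))) (insert i (insert j (S ∩ T))) (by grind) (by grind)
    have k10 := hsup (insert i (S ∩ T)) (insert j (S ∪ T)) (insert i (insert j (S ∪ T)))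
      (S ∩ T) (by grind) (by grind)
    have k11 := hlt (S ∩ T) (by simp [hiS]) (by simp [hjS])
    by_cases hiA : i ∈ A <;> by_cases hjA : j ∈ A <;> by_cases hiB : i ∈ B <;>
      by_cases hjB : j ∈ B <;> simp [hiA, hjA, hiB, hjB] <;> omega

end symmetrize

lemma IsRepresentedBy.symmetrize {n : ℕ} {f : Finset (Fin n) → ℤ}
    {P Q A B : MvPolynomial (Fin n) ℤ} (hP : IsRepresentedBy f P Q) {i j : Fin n} (hij : i ≠ j)
    (hrel : (X i - X j) * A = P - rename (Equiv.swap i j) P)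
    (hrel' : (X i - X j) * B = (1 - X j) * Q - rename (Equiv.swap i j) ((1 - X j) * Q))
    (hsymm : rename (Equiv.swap i j) A = A) (hone : ∀ a, coeff a A ≤ 1)
    (hle : ∀ a, coeff a P ≤ coeff a (X i * A)) : IsRepresentedBy (symmetrize f i j) A B := by
  have hf := hP.supermodular
  have hslice : ∀ {c α β γ}, IsSlice f i j c α β γ → β + 1 ≤ α ∧ (α = β + 1 ∨ γ = α + β) :=
    fun h => h.dichotomy hP hij hrel hsymm hone hle
  have hlt : ∀ S, i ∉ S → j ∉ S → f (insert j S) + 1 ≤ f (insert i S) := by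
    intro S hi hj
    obtain ⟨b, hb, ht⟩ := hf.exists_mem_tight (insert i S)
    obtain ⟨α, β, γ, h⟩ := exists_isSlice f i j b fun S _ _ => hb S
    have h1 := (hslice h).1
    have h2 := (h.put_mem_upset_iff hij (b i) (b j)).1 (by rwa [put_self])
    have h3 := h.le S hi hj
    rw [wt_insert _ hi] at ht
    omega
  have hg := isSupermodular_symmetrize hf hij hlt
  have hno : ∀ {g : Finset (Fin n) → ℤ}, (∀ S, i ∉ S → j ∉ S → g S = f S) → ∀ {c : Fin n →₀ ℕ},
      (¬ ∀ S, i ∉ S → j ∉ S → f S ≤ wt c S) → ∀ p q, put c i j p q ∉ upset g := by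
    intro g hgf c hc p q hmem
    refine hc fun S hi hj => ?_
    have := hmem S
    rwa [wt_put c hij p q hi hj, hgf S hi hj] at this
  have hslice' : ∀ {c α β γ}, IsSlice f i j c α β γ →
      IsSlice (_root_.symmetrize f i j) i j c β β (γ - 1) := by
    intro c α β γ h
    refine ⟨fun S hi hj => ?_, ?_, ?_, ?_⟩
    · rw [symmetrize_of_notMem f hi hj, symmetrize_insert_left f hij hi hj,
        symmetrize_insert_right f hij hi hj, symmetrize_insert_insert f hij hi hj]
      have := h.le S hi hj
      omega
    · obtain ⟨S, hi, hj, hS⟩ := h.exists_right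
      exact ⟨S, hi, hj, by rw [symmetrize_insert_left f hij hi hj, hS]⟩
    · obtain ⟨S, hi, hj, hS⟩ := h.exists_right
      exact ⟨S, hi, hj, by rw [symmetrize_insert_right f hij hi hj, hS]⟩
    · obtain ⟨S, hi, hj, hS⟩ := h.exists_both
      exact ⟨S, hi, hj, by rw [symmetrize_insert_insert f hij hi hj, hS]; ring⟩
  have huniv : _root_.symmetrize f i j Finset.univ = f Finset.univ - 1 := by
    have := symmetrize_insert_insert f hij (S := (Finset.univ.erase i).erase j)
      (by simp) (by simp)
    rwa [insert_insert_erase_erase hij] at this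
  have hwuniv : ∀ c : Fin n →₀ ℕ,
      wt c Finset.univ = c i + c j + wt c ((Finset.univ.erase i).erase j) := by
    intro c
    rw [← wt_put_insert_insert c hij (c i) (c j) (S := (Finset.univ.erase i).erase j)
      (by simp) (by simp), insert_insert_erase_erase hij, put_self]
  have hvanish : ∀ {T : (Fin n →₀ ℕ) → MvPolynomial (Fin n) ℤ →ₗ[ℤ] ℤ} {R : MvPolynomial (Fin n) ℤ}
      {c : Fin n →₀ ℕ}, (¬ ∀ S, i ∉ S → j ∉ S → f S ≤ wt c S) →
      (∀ b ∉ upset f, T b R = 0) → ∀ p q, slice T c i j R p q = 0 := by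
    intro T R c hc hR p q
    unfold slice
    split_ifs
    · exact hR _ (hno (fun _ _ _ => rfl) hc _ _)
    · rfl
  refine ⟨hg, fun a => ?_, fun b => ?_⟩
  · have hT := isShiftFamily_lcoeff n
    have h1 := slice_sub_of_mul_eq a hT hij hrel
    rw [← lcoeff_apply (R := ℤ), ← slice_self (T := lcoeff ℤ) (i := i) (j := j)]
    by_cases ha : ∀ S, i ∉ S → j ∉ S → f S ≤ wt a S
    · obtain ⟨α, β, γ, h⟩ := exists_isSlice f i j a ha
      have hβ := h.nonneg_right hf
      have hγ := h.add_le hf hij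
      have hd := hslice h
      have hle := (h.le ((Finset.univ.erase i).erase j) (by simp) (by simp)).2.2.2
      rw [insert_insert_erase_erase hij] at hle
      set W := wt a ((Finset.univ.erase i).erase j) with hW
      have hE := eq_zero_of_antidiagonal_eq (E := fun p q => slice (lcoeff ℤ) a i j A p q -
        if β ≤ p ∧ β ≤ q ∧ γ - 1 ≤ p + q ∧ p + q + W = f Finset.univ - 1 then 1 else 0)
        (fun p q => by
          have h2 := h1 p q
          rw [slice_coeff_eq hP hij h, slice_coeff_eq hP hij h] at h2
          split_ifs at h2 ⊢ <;> omega)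
        (fun p q hq => by
          rw [slice_of_neg_right a A p hq, if_neg (by omega), sub_zero]) (a i) (a j)
      rw [sub_eq_zero.1 hE, huniv, hwuniv, ← hW]
      have h3 := (hslice' h).put_mem_upset_iff hij (a i) (a j)
      rw [put_self] at h3
      rw [h3]
      simp only [and_assoc]
    · have h2 := hvanish (T := lcoeff ℤ) (R := P) ha fun b hb => by
        rw [lcoeff_apply, hP.coeff_eq, if_neg (by tauto)]
      have h3 := hno (fun S hi hj => symmetrize_of_notMem f hi hj) ha (a i) (a j)
      rw [put_self] at h3
      rw [if_neg (by tauto)]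
      refine eq_zero_of_antidiagonal_eq (fun p q => ?_)
        (fun p q hq => slice_of_neg_right a A p hq) _ _
      have := h1 p q
      rw [h2, h2] at this
      omega
  · have hT := isShiftFamily_coeffSum n
    have h1 : ∀ p q, slice coeffSum b i j B (p - 1) q - slice coeffSum b i j B p (q - 1) =
        slice coeffSum b i j Q p q - slice coeffSum b i j Q p (q - 1) -
        (slice coeffSum b i j Q q p - slice coeffSum b i j Q q (p - 1)) := by
      intro p q
      rw [slice_sub_of_mul_eq b hT hij hrel', sub_mul, one_mul, slice_sub, slice_sub,
        slice_X_mul_right b hT hij, slice_X_mul_right b hT hij]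
    rw [← slice_self (T := coeffSum) (i := i) (j := j)]
    by_cases hb : ∀ S, i ∉ S → j ∉ S → f S ≤ wt b S
    · obtain ⟨α, β, γ, h⟩ := exists_isSlice f i j b hb
      have hβ := h.nonneg_right hf
      have hγ := h.add_le hf hij
      have hd := hslice h
      have hE := eq_zero_of_antidiagonal_eq (E := fun p q => slice coeffSum b i j B p q -
        if β ≤ p ∧ β ≤ q ∧ γ - 1 ≤ p + q then 1 else 0)
        (fun p q => by
          have h2 := h1 p q
          rw [slice_coeffSum_eq hP hij h, slice_coeffSum_eq hP hij h, slice_coeffSum_eq hP hij h,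
            slice_coeffSum_eq hP hij h] at h2
          split_ifs at h2 ⊢ <;> omega)
        (fun p q hq => by
          rw [slice_of_neg_right b B p hq, if_neg (by omega), sub_zero]) (b i) (b j)
      rw [sub_eq_zero.1 hE]
      have h3 := (hslice' h).put_mem_upset_iff hij (b i) (b j)
      rw [put_self] at h3
      rw [h3]
      split_ifs <;> rfl
    · have h2 := hvanish (T := coeffSum) (R := Q) hb fun b hb => by
        rw [hP.coeffSum_eq, if_neg hb]
      have h3 := hno (fun S hi hj => symmetrize_of_notMem f hi hj) hb (b i) (b j)
      rw [put_self] at h3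
      rw [if_neg h3]
      refine eq_zero_of_antidiagonal_eq (fun p q => ?_)
        (fun p q hq => slice_of_neg_right b B p hq) _ _
      have := h1 p q
      rw [h2, h2, h2, h2] at this
      omega

lemma isRepresentedBy_monomial {n : ℕ} (d : Fin n →₀ ℕ) :
    IsRepresentedBy (wt d) (monomial d 1) (monomial d 1) := by
  have hmem : ∀ b, b ∈ upset (wt d) ↔ d ≤ b := by
    refine fun b => ⟨fun h k => ?_, wt_mono⟩
    simpa [wt] using h {k}
  refine ⟨⟨wt_empty d, wt_nonneg d, fun S T => (wt_union_add_wt_inter d S T).ge⟩,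
    fun a => ?_, fun b => ?_⟩
  · rw [coeff_monomial, hmem]
    congr 1
    rw [eq_iff_iff]
    refine ⟨by rintro rfl; exact ⟨le_rfl, rfl⟩, fun ⟨h1, h2⟩ => ?_⟩
    ext k
    have h3 := (Finset.sum_eq_sum_iff_of_le fun k _ => Nat.cast_le (α := ℤ).2 (h1 k)).1 h2.symm k
      (Finset.mem_univ k)
    exact_mod_cast h3
  · simp only [coeffSum_apply, coeff_monomial, Finset.sum_ite_eq, Finset.mem_Iic, hmem]

lemma exists_isRepresentedBy {n : ℕ} {S G : Equiv.Perm (Fin n) → MvPolynomial (Fin n) ℤ}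
    (hS : IsSchubertFamily S) (hG : IsGrothendieckFamily G) : ∀ w : Equiv.Perm (Fin n),
    (∀ a, coeff a (S w) ≤ 1) → ∃ f, IsRepresentedBy f (S w) (G w) := by
  intro w
  induction hN : permWeight w using Nat.strong_induction_on generalizing w with
  | _ N ih =>
  intro hmf
  by_cases hw : w = Fin.revPerm
  · rw [hw, hS.1, hG.1, prod_X_pow_rev]
    exact ⟨_, isRepresentedBy_monomial _⟩
  obtain ⟨i, j, hij, hlt, hmin⟩ := exists_first_ascent w hw
  have hne : i ≠ j := by rintro rfl; omega
  have hle := hS.coeff_swap_le w hij hlt hmin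
  obtain ⟨f, hf⟩ := ih _ (hN ▸ permWeight_mul_swap_lt w (by omega) hlt) (w * Equiv.swap i j) rfl
    fun a => (hle a).trans (by
      rw [coeff_X_mul']
      split_ifs
      · exact hmf _
      · norm_num)
  have hrel := hS.2 (w * Equiv.swap i j) i j hij (by simpa using hlt)
  have hrel' := hG.2 (w * Equiv.swap i j) i j hij (by simpa using hlt)
  rw [mul_assoc, Equiv.swap_mul_self, mul_one] at hrel hrel'
  exact ⟨_, hf.symmetrize hne hrel hrel' (hS.rename_swap_eq_self w hij hlt) hmf hle⟩

lemma IsRepresentedBy.mem_upset_iff {n : ℕ} {f : Finset (Fin n) → ℤ}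
    {P Q : MvPolynomial (Fin n) ℤ} (h : IsRepresentedBy f P Q) (b : Fin n →₀ ℕ) :
    b ∈ upset f ↔ ∃ a ∈ P.support, a ≤ b := by
  constructor
  · intro hb
    obtain ⟨a, hab, ha, ha'⟩ := h.supermodular.exists_le_base hb
    refine ⟨a, ?_, hab⟩
    rw [mem_support_iff, h.coeff_eq, if_pos ⟨ha, ha'.symm⟩]
    exact one_ne_zero
  · rintro ⟨a, ha, hab⟩ S
    rw [mem_support_iff, h.coeff_eq] at ha
    exact ((ite_ne_right_iff.1 ha).1.1 S).trans (wt_mono hab S)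

lemma IsRepresentedBy.coeff_eq_zero {n : ℕ} {f : Finset (Fin n) → ℤ}
    {P Q : MvPolynomial (Fin n) ℤ} (h : IsRepresentedBy f P Q) (b : Fin n →₀ ℕ)
    (hb : b ∉ upset f) : coeff b Q = 0 := by
  induction b using WellFoundedLT.induction with
  | _ b ih =>
  have h1 := h.coeffSum_eq b
  rw [if_neg hb, coeffSum_apply, Finset.sum_eq_single b] at h1
  · exact h1
  · intro a ha hne
    have hab := Finset.mem_Iic.1 ha
    exact ih a (lt_of_le_of_ne hab hne) fun hmem => hb fun S => (hmem S).trans (wt_mono hab S)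
  · simp

/-- Let `w ∈ S_n` (`n ≥ 1`) be such that the Schubert polynomial `𝔖_w` is
multiplicity-free.  Let `P' = {b ∈ ℕ^n : ∃ a ∈ supp 𝔖_w, a ≤ b}` (componentwise order)
and let `μ : P' → ℤ` satisfy `∑_{a ∈ P', a ≤ b} μ a = 1` for every `b ∈ P'` (such a `μ`
exists and is unique).  Then the coefficient of `x^b` in `𝔊_w` is `μ b` if `b ∈ P'`
and `0` otherwise. -/
theorem grothendieck_coeff_eq_mobius {n : ℕ} (hn : 1 ≤ n)
    (S G : Equiv.Perm (Fin n) → MvPolynomial (Fin n) ℤ)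
    (hS : IsSchubertFamily S) (hG : IsGrothendieckFamily G)
    (w : Equiv.Perm (Fin n))
    (hmf : ∀ m : Fin n →₀ ℕ, (S w).coeff m = 0 ∨ (S w).coeff m = 1)
    (μ : (Fin n →₀ ℕ) → ℤ)
    (hμ : ∀ b : Fin n →₀ ℕ, (∃ a ∈ (S w).support, a ≤ b) →
      ∑ a ∈ (Finset.Iic b).filter (fun a => ∃ c ∈ (S w).support, c ≤ a), μ a = 1) :
    (∀ b : Fin n →₀ ℕ, (∃ a ∈ (S w).support, a ≤ b) → (G w).coeff b = μ b) ∧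
    (∀ b : Fin n →₀ ℕ, ¬ (∃ a ∈ (S w).support, a ≤ b) → (G w).coeff b = 0) := by
  obtain ⟨f, hf⟩ := exists_isRepresentedBy hS hG w fun a => by
    rcases hmf a with h | h <;> rw [h]
    norm_num
  have hzero : ∀ b : Fin n →₀ ℕ, ¬ (∃ a ∈ (S w).support, a ≤ b) → (G w).coeff b = 0 :=
    fun b hb => hf.coeff_eq_zero b (by rwa [hf.mem_upset_iff])
  refine ⟨fun b => ?_, hzero⟩
  induction b using WellFoundedLT.induction with
  | _ b ih =>
  intro hb
  have hmem : b ∈ (Finset.Iic b).filter fun a => ∃ c ∈ (S w).support, c ≤ a :=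
    Finset.mem_filter.2 ⟨Finset.mem_Iic.2 le_rfl, hb⟩
  have h1 := hf.coeffSum_eq b
  rw [if_pos ((hf.mem_upset_iff b).2 hb), coeffSum_apply,
    ← Finset.sum_filter_of_ne (p := fun a => ∃ c ∈ (S w).support, c ≤ a)
      (fun a _ ha => by_contra fun hcon => ha (hzero a hcon)), ← hμ b hb,
    ← Finset.sum_erase_add _ _ hmem, ← Finset.sum_erase_add _ _ hmem] at h1
  refine add_left_cancel (h1.trans (congrArg (· + μ b) (Finset.sum_congr rfl fun a ha => ?_)).symm)
  simp only [Finset.mem_erase, Finset.mem_filter, Finset.mem_Iic] at ha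
  exact ih a (lt_of_le_of_ne ha.2.1 ha.1) ha.2.2
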